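/- Let d ≥ 1, let α, β ∈ [0,1], and let δ ∈ (0,1] satisfy δ ≥ α/2 − β/2. Let f : ℝ^d → ℝ be bounded and measurable with ‖f‖_{C^α} < ∞. Then there exists a constant N = N(d, α, β, δ) such that for all 0 < s ≤ t ≤ 1, ‖P_t f − P_s f‖_{C^β} ≤ N·‖f‖_{C^α}·s^{α/2−β/2−δ}·(t−s)^δ. -/

import Mathlib

open MeasureTheory

/-- The Gaussian heat semigroup `P_t f = p_t * f` on `ℝ^d`. -/
noncomputable def heatP (d : ℕ) (t : ℝ) (f : EuclideanSpace ℝ (Fin d) → ℝ)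
    (x : EuclideanSpace ℝ (Fin d)) : ℝ :=
  ∫ y, (2 * Real.pi * t) ^ (-(d : ℝ) / 2) * Real.exp (-‖x - y‖ ^ 2 / (2 * t)) * f y

/-- radial kernel -/
noncomputable def kphi (p r ρ : ℝ) : ℝ := (2 * Real.pi * r) ^ p * Real.exp (-ρ ^ 2 / (2 * r))

noncomputable def kpsi (p r ρ : ℝ) : ℝ := (p / r + ρ ^ 2 / (2 * r ^ 2)) * kphi p r ρ

lemma kphi_hasDerivAt_r (p r ρ : ℝ) (hr : 0 < r) :
    HasDerivAt (fun r => kphi p r ρ) (kpsi p r ρ) r := by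
  have hpi := Real.pi_pos
  have h1 : HasDerivAt (fun r : ℝ => 2 * Real.pi * r) (2 * Real.pi) r := by
    simpa using (hasDerivAt_id r).const_mul (2 * Real.pi)
  have h2 := h1.rpow_const (p := p) (Or.inl (by positivity))
  have h3 : HasDerivAt (fun r : ℝ => -ρ ^ 2 / (2 * r)) (ρ ^ 2 / (2 * r ^ 2)) r := by
    have := ((hasDerivAt_id r).inv hr.ne').const_mul (-ρ ^ 2 / 2)
    convert! this using 1
    · ext y; simp; try ring
    · simp; ring
  have h4 := h2.mul h3.exp
  unfold kpsi kphi
  convert! h4 using 1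
  rw [Real.rpow_sub_one (by positivity)]
  field_simp

lemma kphi_hasDerivAt_rho (p r ρ : ℝ) :
    HasDerivAt (fun ρ => kphi p r ρ) (-(ρ / r) * kphi p r ρ) ρ := by
  have h3 : HasDerivAt (fun ρ : ℝ => -ρ ^ 2 / (2 * r)) (-(ρ / r)) ρ := by
    have := (((hasDerivAt_id ρ).pow 2).const_mul (-1 / (2 * r)))
    convert! this using 1
    · ext y; simp; try ring
    · simp; ring
  have h4 := h3.exp.const_mul ((2 * Real.pi * r) ^ p)
  unfold kphi
  convert! h4 using 1
  ring

lemma kpsi_hasDerivAt_rho (p r ρ : ℝ) :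
    HasDerivAt (fun ρ => kpsi p r ρ)
      ((ρ / r ^ 2 - (ρ / r) * (p / r + ρ ^ 2 / (2 * r ^ 2))) * kphi p r ρ) ρ := by
  have h3 : HasDerivAt (fun ρ : ℝ => p / r + ρ ^ 2 / (2 * r ^ 2)) (ρ / r ^ 2) ρ := by
    have := (((hasDerivAt_id ρ).pow 2).const_mul (1 / (2 * r ^ 2))).const_add (p / r)
    convert! this using 1
    · ext y; simp; try ring
    · simp; ring
  have h4 := h3.mul (kphi_hasDerivAt_rho p r ρ)
  unfold kpsi
  convert! h4 using 1
  ring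

lemma kphi_nonneg (p r ρ : ℝ) (hr : 0 < r) : 0 ≤ kphi p r ρ := by
  have hpi := Real.pi_pos
  unfold kphi; positivity

lemma kphi_le (p r ρ : ℝ) (hp : p ≤ 0) (hr : 1 ≤ r) (hr2 : r ≤ 2) :
    kphi p r ρ ≤ Real.exp (-ρ ^ 2 / 4) := by
  have hpi := Real.pi_gt_three
  have h1 : (2 * Real.pi * r) ^ p ≤ 1 :=
    Real.rpow_le_one_of_one_le_of_nonpos (by nlinarith) hp
  have h2 : Real.exp (-ρ ^ 2 / (2 * r)) ≤ Real.exp (-ρ ^ 2 / 4) := by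
    apply Real.exp_le_exp.mpr
    rw [neg_div, neg_div, neg_le_neg_iff]
    gcongr; linarith
  unfold kphi
  calc _ ≤ 1 * Real.exp (-ρ ^ 2 / 4) := by gcongr
    _ = _ := one_mul _

lemma poly_exp (ρ : ℝ) : (1 + ρ ^ 2) ^ 2 * Real.exp (-ρ ^ 2 / 4) ≤ 256 * Real.exp (-ρ ^ 2 / 8) := by
  have h1 : 1 + ρ ^ 2 ≤ 16 * Real.exp (ρ ^ 2 / 16) := by
    have := Real.add_one_le_exp (ρ ^ 2 / 16); nlinarith [sq_nonneg ρ]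
  have h2 : (1 + ρ ^ 2) ^ 2 ≤ (16 * Real.exp (ρ ^ 2 / 16)) ^ 2 := by gcongr
  have h3 : (16 * Real.exp (ρ ^ 2 / 16)) ^ 2 = 256 * Real.exp (ρ ^ 2 / 8) := by
    rw [mul_pow, ← Real.exp_nat_mul]; norm_num; ring_nf
  calc _ ≤ (256 * Real.exp (ρ ^ 2 / 8)) * Real.exp (-ρ ^ 2 / 4) := by rw [← h3]; gcongr
    _ = _ := by rw [mul_assoc, ← Real.exp_add]; ring_nf

lemma gen_bound (p r ρ c A : ℝ) (hp : p ≤ 0) (hr : 1 ≤ r) (hr2 : r ≤ 2) (hA : 0 ≤ A)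
    (h : |c| ≤ A * (1 + ρ ^ 2) ^ 2) :
    |c * kphi p r ρ| ≤ 256 * A * Real.exp (-ρ ^ 2 / 8) := by
  rw [abs_mul, abs_of_nonneg (kphi_nonneg p r ρ (by linarith))]
  have h0 := kphi_nonneg p r ρ (by linarith)
  calc _ ≤ (A * (1 + ρ ^ 2) ^ 2) * Real.exp (-ρ ^ 2 / 4) :=
        mul_le_mul h (kphi_le p r ρ hp hr hr2) h0 (by positivity)
    _ = A * ((1 + ρ ^ 2) ^ 2 * Real.exp (-ρ ^ 2 / 4)) := by ring
    _ ≤ A * (256 * Real.exp (-ρ ^ 2 / 8)) := mul_le_mul_of_nonneg_left (poly_exp ρ) hA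
    _ = _ := by ring

lemma coef_bound (p r ρ : ℝ) (hp : p ≤ 0) (hr : 1 ≤ r) :
    |p / r + ρ ^ 2 / (2 * r ^ 2)| ≤ (1 - p) * (1 + ρ ^ 2) := by
  have hr0 : 0 < r := by linarith
  have h1 : |p / r| ≤ -p := by
    rw [abs_div, abs_of_nonpos hp, abs_of_pos hr0]
    exact div_le_self (by linarith) hr
  have h2 : |ρ ^ 2 / (2 * r ^ 2)| ≤ ρ ^ 2 := by
    rw [abs_of_nonneg (by positivity)]
    exact div_le_self (by positivity) (by nlinarith)
  calc _ ≤ |p / r| + |ρ ^ 2 / (2 * r ^ 2)| := abs_add_le _ _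
    _ ≤ -p + ρ ^ 2 := add_le_add h1 h2
    _ ≤ _ := by nlinarith [sq_nonneg ρ]

lemma abs_le_one_add_sq (ρ : ℝ) : |ρ| ≤ 1 + ρ ^ 2 := by
  rw [← sq_abs]; nlinarith [sq_nonneg (|ρ| - 1), sq_nonneg (|ρ|)]

lemma kpsi_bound (p r ρ : ℝ) (hp : p ≤ 0) (hr : 1 ≤ r) (hr2 : r ≤ 2) :
    |kpsi p r ρ| ≤ 512 * (1 - p) * Real.exp (-ρ ^ 2 / 8) := by
  unfold kpsi
  have := gen_bound p r ρ (p / r + ρ ^ 2 / (2 * r ^ 2)) (1 - p) hp hr hr2 (by linarith) (by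
    refine (coef_bound p r ρ hp hr).trans ?_
    apply mul_le_mul_of_nonneg_left _ (by linarith)
    nlinarith [sq_nonneg ρ])
  refine this.trans ?_
  gcongr <;> linarith

lemma dphi_bound (p r ρ : ℝ) (hp : p ≤ 0) (hr : 1 ≤ r) (hr2 : r ≤ 2) :
    |-(ρ / r) * kphi p r ρ| ≤ 512 * (1 - p) * Real.exp (-ρ ^ 2 / 8) := by
  have := gen_bound p r ρ (-(ρ / r)) (1 - p) hp hr hr2 (by linarith) (by
    rw [abs_neg, abs_div, abs_of_pos (by linarith : 0 < r)]
    refine (div_le_self (abs_nonneg _) hr).trans ((abs_le_one_add_sq ρ).trans ?_)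
    nlinarith [sq_nonneg ρ, mul_nonneg (neg_nonneg.mpr hp) (sq_nonneg (1 + ρ ^ 2))])
  refine this.trans ?_
  gcongr <;> linarith

lemma dpsi_bound (p r ρ : ℝ) (hp : p ≤ 0) (hr : 1 ≤ r) (hr2 : r ≤ 2) :
    |(ρ / r ^ 2 - (ρ / r) * (p / r + ρ ^ 2 / (2 * r ^ 2))) * kphi p r ρ|
      ≤ 512 * (1 - p) * Real.exp (-ρ ^ 2 / 8) := by
  have hr0 : 0 < r := by linarith
  have e1 : |ρ / r ^ 2| ≤ 1 + ρ ^ 2 := by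
    rw [abs_div, abs_of_pos (by positivity : 0 < r ^ 2)]
    exact (div_le_self (abs_nonneg _) (by nlinarith)).trans (abs_le_one_add_sq ρ)
  have e2 : |ρ / r| ≤ 1 + ρ ^ 2 := by
    rw [abs_div, abs_of_pos hr0]
    exact (div_le_self (abs_nonneg _) hr).trans (abs_le_one_add_sq ρ)
  have := gen_bound p r ρ (ρ / r ^ 2 - (ρ / r) * (p / r + ρ ^ 2 / (2 * r ^ 2)))
    (2 * (1 - p)) hp hr hr2 (by linarith) (by
    refine (abs_sub _ _).trans ?_
    rw [abs_mul]
    have e3 := mul_le_mul e2 (coef_bound p r ρ hp hr) (abs_nonneg _) (by positivity)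
    nlinarith [sq_nonneg ρ, mul_nonneg (neg_nonneg.mpr hp) (sq_nonneg (1 + ρ ^ 2))])
  refine this.trans (le_of_eq (by ring))

lemma mvt (f f' : ℝ → ℝ) (a b C : ℝ) (h : ∀ x ∈ Set.uIcc a b, HasDerivAt f (f' x) x)
    (hC : ∀ x ∈ Set.uIcc a b, |f' x| ≤ C) : |f a - f b| ≤ C * |a - b| := by
  have := (convex_uIcc a b).norm_image_sub_le_of_norm_hasDerivWithin_le
    (f := f) (f' := f') (C := C) (fun x hx => (h x hx).hasDerivWithinAt) hC
    Set.right_mem_uIcc Set.left_mem_uIcc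
  simpa using this

lemma exp_shift (a b ρ : ℝ) (hab : |a - b| ≤ 1) (hρ : ρ ∈ Set.uIcc a b) :
    Real.exp (-ρ ^ 2 / 8) ≤ 2 * Real.exp (-a ^ 2 / 16) := by
  have h1 : |ρ - a| ≤ 1 := by
    have := Set.abs_sub_left_of_mem_uIcc hρ
    rw [abs_sub_comm b a] at this
    linarith
  have h2 : -ρ ^ 2 / 8 ≤ 1 / 8 + -a ^ 2 / 16 := by
    have := abs_le.mp h1
    nlinarith [sq_nonneg (ρ + (ρ - a))]
  calc _ ≤ Real.exp (1 / 8 + -a ^ 2 / 16) := Real.exp_le_exp.mpr h2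
    _ = Real.exp (1 / 8) * Real.exp (-a ^ 2 / 16) := Real.exp_add _ _
    _ ≤ _ := by
      gcongr
      have := Real.exp_one_lt_d9
      have h3 : Real.exp (1/8) ^ 8 = Real.exp 1 := by rw [← Real.exp_nat_mul]; norm_num
      by_contra hc
      push Not at hc
      have : (2:ℝ) ^ 8 < Real.exp (1/8) ^ 8 := by gcongr
      norm_num at this; linarith

lemma KB1 (p r ρ : ℝ) (hp : p ≤ 0) (hr : 1 ≤ r) (hr2 : r ≤ 2) :
    |kphi p r ρ - kphi p 1 ρ| ≤ 1024 * (1 - p) * (r - 1) * Real.exp (-ρ ^ 2 / 16) := by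
  have := mvt (fun r => kphi p r ρ) (fun r => kpsi p r ρ) r 1
    (1024 * (1 - p) * Real.exp (-ρ ^ 2 / 16))
    (fun x hx => by
      rw [Set.uIcc_of_ge hr] at hx
      exact kphi_hasDerivAt_r p x ρ (by linarith [hx.1]))
    (fun x hx => by
      rw [Set.uIcc_of_ge hr] at hx
      refine (kpsi_bound p x ρ hp hx.1 (hx.2.trans hr2)).trans ?_
      have : Real.exp (-ρ ^ 2 / 8) ≤ Real.exp (-ρ ^ 2 / 16) :=
        Real.exp_le_exp.mpr (by nlinarith [sq_nonneg ρ])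
      have h0 : 0 ≤ Real.exp (-ρ ^ 2 / 16) := (Real.exp_pos _).le
      have := mul_le_mul_of_nonneg_left this (by linarith : 0 ≤ 512 * (1 - p))
      have := mul_nonneg (by linarith : 0 ≤ 512 * (1 - p)) h0
      linarith)
  rw [abs_of_nonneg (by linarith : 0 ≤ r - 1)] at this
  linarith

lemma KB2 (p a b : ℝ) (hp : p ≤ 0) (hab : |a - b| ≤ 1) :
    |kphi p 1 a - kphi p 1 b| ≤ 1024 * (1 - p) * |a - b| * Real.exp (-a ^ 2 / 16) := by
  have := mvt (fun ρ => kphi p 1 ρ) (fun ρ => -(ρ / 1) * kphi p 1 ρ) a b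
    (1024 * (1 - p) * Real.exp (-a ^ 2 / 16))
    (fun x hx => kphi_hasDerivAt_rho p 1 x)
    (fun x hx => by
      refine (dphi_bound p 1 x hp le_rfl (by norm_num)).trans ?_
      have := mul_le_mul_of_nonneg_left (exp_shift a b x hab hx) (by linarith : 0 ≤ 512 * (1 - p))
      linarith)
  linarith

lemma KB3 (p r a b : ℝ) (hp : p ≤ 0) (hr : 1 ≤ r) (hr2 : r ≤ 2) (hab : |a - b| ≤ 1) :
    |(kphi p r a - kphi p r b) - (kphi p 1 a - kphi p 1 b)|
      ≤ 1024 * (1 - p) * ((r - 1) * |a - b|) * Real.exp (-a ^ 2 / 16) := by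
  have := mvt (fun r => kphi p r a - kphi p r b) (fun r => kpsi p r a - kpsi p r b) r 1
    (1024 * (1 - p) * |a - b| * Real.exp (-a ^ 2 / 16))
    (fun x hx => by
      rw [Set.uIcc_of_ge hr] at hx
      exact (kphi_hasDerivAt_r p x a (by linarith [hx.1])).sub
        (kphi_hasDerivAt_r p x b (by linarith [hx.1])))
    (fun r' hx => by
      rw [Set.uIcc_of_ge hr] at hx
      have := mvt (fun ρ => kpsi p r' ρ) _ a b
        (1024 * (1 - p) * Real.exp (-a ^ 2 / 16))
        (fun x hx => kpsi_hasDerivAt_rho p r' x)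
        (fun x hx' => by
          refine (dpsi_bound p r' x hp hx.1 (hx.2.trans hr2)).trans ?_
          have := mul_le_mul_of_nonneg_left (exp_shift a b x hab hx')
            (by linarith : 0 ≤ 512 * (1 - p))
          linarith)
      linarith)
  rw [abs_of_nonneg (by linarith : 0 ≤ r - 1)] at this
  linarith

abbrev EE (d : ℕ) := EuclideanSpace ℝ (Fin d)

lemma int_exp (d : ℕ) (b : ℝ) (hb : 0 < b) :
    Integrable (fun z : EE d => Real.exp (-b * ‖z‖ ^ 2)) := by
  have h := GaussianFourier.integrable_cexp_neg_mul_sq_norm_add (V := EE d) (b := (b : ℂ))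
    (by simpa using hb) 0 0
  have h2 := h.re
  refine h2.congr (Filter.Eventually.of_forall fun z => ?_)
  simp only [zero_mul, add_zero]
  have : (-(b : ℂ) * (‖z‖ : ℂ) ^ 2) = ((-b * ‖z‖ ^ 2 : ℝ) : ℂ) := by push_cast; ring
  rw [this, ← Complex.ofReal_exp]
  exact Complex.ofReal_re _

lemma kphi_eq (p r ρ : ℝ) :
    kphi p r ρ = (2 * Real.pi * r) ^ p * Real.exp (-(1 / (2 * r)) * ρ ^ 2) := by
  unfold kphi; congr 2; ring

lemma int_kphi (d : ℕ) (p r : ℝ) (hr : 0 < r) :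
    Integrable (fun z : EE d => kphi p r ‖z‖) := by
  simp_rw [kphi_eq]
  exact (int_exp d _ (by positivity)).const_mul _

lemma integral_kphi (d : ℕ) (r : ℝ) (hr : 0 < r) :
    ∫ z : EE d, kphi (-(d : ℝ) / 2) r ‖z‖ = 1 := by
  have hpi := Real.pi_pos
  simp_rw [kphi_eq]
  rw [integral_const_mul, GaussianFourier.integral_rexp_neg_mul_sq_norm (by positivity)]
  have : Real.pi / (1 / (2 * r)) = 2 * Real.pi * r := by field_simp
  rw [this, ← Real.rpow_add (by positivity)]
  simp
  ring_nf
  simp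

/-- the dominating constant -/
noncomputable def cI (d : ℕ) : ℝ := ∫ z : EE d, Real.exp (-‖z‖ ^ 2 / 16) * (1 + ‖z‖)

lemma int_dom (d : ℕ) : Integrable (fun z : EE d => Real.exp (-‖z‖ ^ 2 / 16) * (1 + ‖z‖)) := by
  refine ((int_exp d (1 / 32) (by norm_num)).const_mul 100).mono'
    (by fun_prop) (Filter.Eventually.of_forall fun z => ?_)
  rw [Real.norm_of_nonneg (by positivity)]
  have h1 : 1 + ‖z‖ ≤ 100 * Real.exp (‖z‖ ^ 2 / 32) := by
    have := Real.add_one_le_exp (‖z‖ ^ 2 / 32)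
    nlinarith [sq_nonneg (‖z‖ - 1)]
  calc _ ≤ Real.exp (-‖z‖ ^ 2 / 16) * (100 * Real.exp (‖z‖ ^ 2 / 32)) := by gcongr
    _ = 100 * (Real.exp (-‖z‖ ^ 2 / 16) * Real.exp (‖z‖ ^ 2 / 32)) := by ring
    _ = _ := by rw [← Real.exp_add]; ring_nf

lemma cI_nonneg (d : ℕ) : 0 ≤ cI d := integral_nonneg fun z => by positivity

lemma rpow_le_one_add (u α : ℝ) (hu : 0 ≤ u) (h0 : 0 ≤ α) (h1 : α ≤ 1) : u ^ α ≤ 1 + u := by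
  rcases le_total u 1 with h | h
  · linarith [Real.rpow_le_one hu h h0]
  · have := Real.rpow_le_rpow_of_exponent_le h h1
    rw [Real.rpow_one] at this; linarith

lemma heatP_eq (d : ℕ) (t : ℝ) (f : EE d → ℝ) (x : EE d) :
    heatP d t f x = ∫ w, kphi (-(d : ℝ) / 2) t ‖x - w‖ * f w := rfl

lemma int_kphi_sub (d : ℕ) (r : ℝ) (hr : 0 < r) (x : EE d) :
    Integrable (fun w : EE d => kphi (-(d : ℝ) / 2) r ‖x - w‖) :=
  (int_kphi d _ r hr).comp_sub_left x

lemma int_kphi_f (d : ℕ) (r : ℝ) (hr : 0 < r) (x : EE d) (f : EE d → ℝ) (M : ℝ)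
    (hf : Measurable f) (hM : ∀ x, |f x| ≤ M) :
    Integrable (fun w : EE d => kphi (-(d : ℝ) / 2) r ‖x - w‖ * f w) :=
  (int_kphi_sub d r hr x).mul_bdd hf.aestronglyMeasurable (Filter.Eventually.of_forall hM)

lemma heatP_sub (d : ℕ) (r : ℝ) (hr : 0 < r) (x : EE d) (f : EE d → ℝ) (M c : ℝ)
    (hf : Measurable f) (hM : ∀ x, |f x| ≤ M) :
    heatP d r f x - c = ∫ w, kphi (-(d : ℝ) / 2) r ‖x - w‖ * (f w - c) := by
  simp_rw [mul_sub]
  rw [integral_sub (int_kphi_f d r hr x f M hf hM) ((int_kphi_sub d r hr x).mul_const c),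
    integral_mul_const, integral_sub_left_eq_self (fun w : EE d => kphi (-(d : ℝ) / 2) r ‖w‖),
    integral_kphi d r hr, heatP_eq, one_mul]

lemma heatP_scale (d : ℕ) (t : ℝ) (ht : 0 < t) (f : EE d → ℝ) (x : EE d) :
    heatP d t f x = ∫ z : EE d, kphi (-(d : ℝ) / 2) 1 ‖z‖ * f (x - √t • z) := by
  have hpi := Real.pi_pos
  have hs : 0 < √t := Real.sqrt_pos.mpr ht
  rw [heatP_eq, ← integral_sub_left_eq_self _ _ x]
  simp only [sub_sub_cancel]
  have h := Measure.integral_comp_smul (volume : Measure (EE d))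
    (fun w => kphi (-(d : ℝ) / 2) t ‖w‖ * f (x - w)) (√t)
  have h2 : ∀ z : EE d, kphi (-(d : ℝ) / 2) t ‖√t • z‖ =
      ((√t) ^ d)⁻¹ * kphi (-(d : ℝ) / 2) 1 ‖z‖ := by
    intro z
    unfold kphi
    rw [norm_smul, Real.norm_of_nonneg hs.le, mul_pow, Real.sq_sqrt ht.le, mul_one,
      Real.mul_rpow (by positivity) ht.le]
    have e1 : t ^ (-(d : ℝ) / 2) = ((√t) ^ d)⁻¹ := by
      rw [Real.sqrt_eq_rpow, ← Real.rpow_natCast, ← Real.rpow_mul ht.le, ← Real.rpow_neg ht.le]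
      congr 1; ring
    have e2 : -(t * ‖z‖ ^ 2) / (2 * t) = -‖z‖ ^ 2 / (2 * 1) := by field_simp
    rw [e1, e2]; ring
  simp only [h2, mul_assoc, integral_const_mul, finrank_euclideanSpace, Fintype.card_fin,
    smul_eq_mul] at h
  rw [abs_of_pos (by positivity)] at h
  exact (mul_left_cancel₀ (by positivity) h).symm

lemma heatP_scaling (d : ℕ) (s t : ℝ) (hs : 0 < s) (ht : 0 < t) (f : EE d → ℝ) (x : EE d) :
    heatP d t f x = heatP d (t / s) (fun z => f (√s • z)) ((√s)⁻¹ • x) := by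
  have hs' : 0 < √s := Real.sqrt_pos.mpr hs
  rw [heatP_scale d t ht, heatP_scale d (t / s) (by positivity)]
  congr 1; ext z
  rw [smul_sub, smul_smul, smul_smul, mul_inv_cancel₀ hs'.ne', one_smul, Real.sqrt_div ht.le,
    mul_div_cancel₀ _ hs'.ne']

/-- general kernel bound -/
lemma ker_bound (d : ℕ) (α : ℝ) (hα0 : 0 ≤ α) (hα1 : α ≤ 1) (L f : EE d → ℝ) (A H : ℝ) (x : EE d)
    (hA : 0 ≤ A) (hH0 : 0 ≤ H) (hL : ∀ w, |L w| ≤ A * Real.exp (-‖x - w‖ ^ 2 / 16))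
    (hH : ∀ x y, |f x - f y| ≤ H * ‖x - y‖ ^ α) :
    |∫ w, L w * (f w - f x)| ≤ A * H * cI d := by
  have h1 : ∀ w, |L w * (f w - f x)| ≤
      A * H * (Real.exp (-‖x - w‖ ^ 2 / 16) * (1 + ‖x - w‖)) := by
    intro w
    rw [abs_mul]
    have h2 : |f w - f x| ≤ H * (1 + ‖x - w‖) := by
      refine (hH w x).trans ?_
      rw [norm_sub_rev]
      exact mul_le_mul_of_nonneg_left (rpow_le_one_add _ _ (norm_nonneg _) hα0 hα1) hH0
    calc _ ≤ (A * Real.exp (-‖x - w‖ ^ 2 / 16)) * (H * (1 + ‖x - w‖)) :=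
          mul_le_mul (hL w) h2 (abs_nonneg _) (by positivity)
      _ = _ := by ring
  have h3 := norm_integral_le_of_norm_le (f := fun w => L w * (f w - f x))
    (((int_dom d).comp_sub_left x).const_mul (A * H))
    (Filter.Eventually.of_forall h1)
  rw [integral_const_mul, integral_sub_left_eq_self
    (fun w : EE d => Real.exp (-‖w‖ ^ 2 / 16) * (1 + ‖w‖))] at h3
  exact h3

/-- overall constant -/
noncomputable def cB (d : ℕ) : ℝ := 1024 * (1 - (-(d : ℝ) / 2)) * cI d

lemma hp (d : ℕ) : -(d : ℝ) / 2 ≤ 0 := by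
  have : (0 : ℝ) ≤ d := Nat.cast_nonneg d
  linarith

lemma cB_nonneg (d : ℕ) : 0 ≤ cB d :=
  mul_nonneg (by linarith [hp d]) (cI_nonneg d)

lemma LB (d : ℕ) (α : ℝ) (hα0 : 0 ≤ α) (hα1 : α ≤ 1) (f : EE d → ℝ) (M H : ℝ)
    (hf : Measurable f) (hM : ∀ x, |f x| ≤ M) (hH0 : 0 ≤ H)
    (hH : ∀ x y, |f x - f y| ≤ H * ‖x - y‖ ^ α)
    (t : ℝ) (ht : 1 ≤ t) (ht2 : t ≤ 2) (x : EE d) :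
    |heatP d t f x - heatP d 1 f x| ≤ cB d * H * (t - 1) := by
  have e : heatP d t f x - heatP d 1 f x = (heatP d t f x - f x) - (heatP d 1 f x - f x) := by ring
  have i1 : ∀ r : ℝ, 0 < r → Integrable (fun w : EE d =>
      kphi (-(d : ℝ) / 2) r ‖x - w‖ * (f w - f x)) := fun r hr => by
    simp_rw [mul_sub]
    exact (int_kphi_f d r hr x f M hf hM).sub ((int_kphi_sub d r hr x).mul_const _)
  rw [e, heatP_sub d t (by linarith) x f M _ hf hM, heatP_sub d 1 (by linarith) x f M _ hf hM,
    ← integral_sub (i1 t (by linarith)) (i1 1 (by linarith))]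
  simp_rw [← sub_mul]
  refine (ker_bound d α hα0 hα1 _ f (1024 * (1 - (-(d : ℝ) / 2)) * (t - 1)) H x
    (mul_nonneg (by linarith [hp d]) (by linarith)) hH0
    (fun w => KB1 _ t _ (hp d) ht ht2) hH).trans (le_of_eq ?_)
  unfold cB; ring

lemma LD2 (d : ℕ) (α : ℝ) (hα0 : 0 ≤ α) (hα1 : α ≤ 1) (f : EE d → ℝ) (M H : ℝ)
    (hf : Measurable f) (hM : ∀ x, |f x| ≤ M) (hH0 : 0 ≤ H)
    (hH : ∀ x y, |f x - f y| ≤ H * ‖x - y‖ ^ α)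
    (x y : EE d) (hxy : ‖x - y‖ ≤ 1) :
    |heatP d 1 f x - heatP d 1 f y| ≤ cB d * H * ‖x - y‖ := by
  have e : heatP d 1 f x - heatP d 1 f y = (heatP d 1 f x - f x) - (heatP d 1 f y - f x) := by ring
  have i1 : ∀ u, Integrable (fun w : EE d =>
      kphi (-(d : ℝ) / 2) 1 ‖u - w‖ * (f w - f x)) := fun u => by
    simp_rw [mul_sub]
    exact (int_kphi_f d 1 one_pos u f M hf hM).sub ((int_kphi_sub d 1 one_pos u).mul_const _)
  rw [e, heatP_sub d 1 (by linarith) x f M _ hf hM, heatP_sub d 1 (by linarith) y f M _ hf hM,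
    ← integral_sub (i1 x) (i1 y)]
  simp_rw [← sub_mul]
  refine (ker_bound d α hα0 hα1 _ f (1024 * (1 - (-(d : ℝ) / 2)) * ‖x - y‖) H x
    (mul_nonneg (by linarith [hp d]) (norm_nonneg _)) hH0
    (fun w => ?_) hH).trans (le_of_eq ?_)
  · have h1 : |‖x - w‖ - ‖y - w‖| ≤ ‖x - y‖ := by
      simpa using abs_norm_sub_norm_le (x - w) (y - w)
    refine (KB2 _ _ _ (hp d) (h1.trans hxy)).trans ?_
    have := hp d
    gcongr
    linarith
  · unfold cB; ring

lemma LC (d : ℕ) (α : ℝ) (hα0 : 0 ≤ α) (hα1 : α ≤ 1) (f : EE d → ℝ) (M H : ℝ)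
    (hf : Measurable f) (hM : ∀ x, |f x| ≤ M) (hH0 : 0 ≤ H)
    (hH : ∀ x y, |f x - f y| ≤ H * ‖x - y‖ ^ α)
    (t : ℝ) (ht : 1 ≤ t) (ht2 : t ≤ 2) (x y : EE d) (hxy : ‖x - y‖ ≤ 1) :
    |(heatP d t f x - heatP d 1 f x) - (heatP d t f y - heatP d 1 f y)|
      ≤ cB d * H * ((t - 1) * ‖x - y‖) := by
  have e : (heatP d t f x - heatP d 1 f x) - (heatP d t f y - heatP d 1 f y)
    = ((heatP d t f x - f x) - (heatP d t f y - f x)) -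
      ((heatP d 1 f x - f x) - (heatP d 1 f y - f x)) := by ring
  have i1 : ∀ r : ℝ, 0 < r → ∀ u, Integrable (fun w : EE d =>
      kphi (-(d : ℝ) / 2) r ‖u - w‖ * (f w - f x)) := fun r hr u => by
    simp_rw [mul_sub]
    exact (int_kphi_f d r hr u f M hf hM).sub ((int_kphi_sub d r hr u).mul_const _)
  have t0 : 0 < t := by linarith
  rw [e, heatP_sub d 1 one_pos x f M _ hf hM, heatP_sub d 1 one_pos y f M _ hf hM,
    heatP_sub d t t0 x f M _ hf hM, heatP_sub d t t0 y f M _ hf hM,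
    ← integral_sub (i1 t t0 x) (i1 t t0 y), ← integral_sub (i1 1 one_pos x) (i1 1 one_pos y),
    ← integral_sub (by exact (i1 t t0 x).sub (i1 t t0 y))
      (by exact (i1 1 one_pos x).sub (i1 1 one_pos y))]
  simp_rw [← sub_mul]
  refine (ker_bound d α hα0 hα1 _ f (1024 * (1 - (-(d : ℝ) / 2)) * ((t - 1) * ‖x - y‖)) H x
    (mul_nonneg (by linarith [hp d]) (mul_nonneg (by linarith) (norm_nonneg _))) hH0
    (fun w => ?_) hH).trans (le_of_eq ?_)
  · have h1 : |‖x - w‖ - ‖y - w‖| ≤ ‖x - y‖ := by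
      simpa using abs_norm_sub_norm_le (x - w) (y - w)
    refine (KB3 _ t _ _ (hp d) ht ht2 (h1.trans hxy)).trans ?_
    have := hp d
    have : 0 ≤ t - 1 := by linarith
    gcongr
    linarith
  · unfold cB; ring

lemma int_scaled (d : ℕ) (f : EE d → ℝ) (M : ℝ)
    (hf : Measurable f) (hM : ∀ x, |f x| ≤ M) (t : ℝ) (x : EE d) :
    Integrable (fun z : EE d => kphi (-(d : ℝ) / 2) 1 ‖z‖ * f (x - √t • z)) :=
  (int_kphi d _ 1 one_pos).mul_bdd (hf.comp (by fun_prop)).aestronglyMeasurable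
    (Filter.Eventually.of_forall fun z => hM _)

lemma LD1 (d : ℕ) (α : ℝ) (f : EE d → ℝ) (M H : ℝ)
    (hf : Measurable f) (hM : ∀ x, |f x| ≤ M)
    (hH : ∀ x y, |f x - f y| ≤ H * ‖x - y‖ ^ α)
    (t : ℝ) (ht : 0 < t) (x y : EE d) :
    |heatP d t f x - heatP d t f y| ≤ H * ‖x - y‖ ^ α := by
  have i := int_scaled d f M hf hM
  rw [heatP_scale d t ht, heatP_scale d t ht, ← integral_sub (i t x) (i t y)]
  simp_rw [← mul_sub]
  have h3 := norm_integral_le_of_norm_le ((int_kphi d (-(d : ℝ) / 2) 1 one_pos).mul_const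
      (H * ‖x - y‖ ^ α)) (f := fun z : EE d => kphi (-(d : ℝ) / 2) 1 ‖z‖ *
        (f (x - √t • z) - f (y - √t • z)))
    (Filter.Eventually.of_forall fun z => by
      rw [norm_mul, Real.norm_of_nonneg (kphi_nonneg _ _ _ one_pos)]
      refine mul_le_mul_of_nonneg_left ?_ (kphi_nonneg _ _ _ one_pos)
      simpa using hH (x - √t • z) (y - √t • z))
  rw [integral_mul_const, integral_kphi d 1 one_pos, one_mul] at h3
  exact h3

lemma LA (d : ℕ) (α : ℝ) (hα0 : 0 ≤ α) (hα1 : α ≤ 1) (f : EE d → ℝ) (M H : ℝ)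
    (hf : Measurable f) (hM : ∀ x, |f x| ≤ M) (hH0 : 0 ≤ H)
    (hH : ∀ x y, |f x - f y| ≤ H * ‖x - y‖ ^ α)
    (t : ℝ) (ht : 1 ≤ t) (x : EE d) :
    |heatP d t f x - heatP d 1 f x| ≤ cI d * H * (t - 1) ^ (α / 2) := by
  have i := int_scaled d f M hf hM
  rw [heatP_scale d t (by linarith), heatP_scale d 1 one_pos, ← integral_sub (i t x) (i 1 x)]
  simp_rw [← mul_sub]
  have hs1 : 1 ≤ √t := by simpa using ht
  have h3 := norm_integral_le_of_norm_le ((int_dom d).mul_const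
      (H * (t - 1) ^ (α / 2))) (f := fun z : EE d => kphi (-(d : ℝ) / 2) 1 ‖z‖ *
        (f (x - √t • z) - f (x - √1 • z)))
    (Filter.Eventually.of_forall fun z => by
      rw [norm_mul, Real.norm_of_nonneg (kphi_nonneg _ _ _ one_pos)]
      have e1 : ‖f (x - √t • z) - f (x - √1 • z)‖ ≤ H * ((t - 1) ^ (α / 2) * (1 + ‖z‖)) := by
        refine (hH _ _).trans (mul_le_mul_of_nonneg_left ?_ hH0)
        have e2 : (x - √t • z) - (x - √1 • z) = -((√t - 1) • z) := by
          rw [sub_smul]; simp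
        rw [e2, norm_neg, norm_smul, Real.norm_of_nonneg (by linarith),
          Real.mul_rpow (by linarith) (norm_nonneg _)]
        have e3 : (√t - 1) ^ α ≤ (t - 1) ^ (α / 2) := by
          have : (t - 1) ^ (α / 2) = √(t - 1) ^ α := by
            rw [Real.sqrt_eq_rpow, ← Real.rpow_mul (by linarith)]; congr 1; ring
          rw [this]
          apply Real.rpow_le_rpow (by linarith) _ hα0
          apply Real.le_sqrt_of_sq_le
          nlinarith [Real.sq_sqrt (by linarith : 0 ≤ t)]
        exact mul_le_mul e3 (rpow_le_one_add _ _ (norm_nonneg _) hα0 hα1) (by positivity)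
          (Real.rpow_nonneg (by linarith) _)
      have e4 : kphi (-(d : ℝ) / 2) 1 ‖z‖ ≤ Real.exp (-‖z‖ ^ 2 / 16) :=
        (kphi_le _ _ _ (hp d) le_rfl (by norm_num)).trans
          (Real.exp_le_exp.mpr (by nlinarith [sq_nonneg ‖z‖]))
      calc _ ≤ Real.exp (-‖z‖ ^ 2 / 16) * (H * ((t - 1) ^ (α / 2) * (1 + ‖z‖))) :=
            mul_le_mul e4 e1 (norm_nonneg _) (Real.exp_pos _).le
        _ = _ := by ring)
  rw [integral_mul_const] at h3
  refine h3.trans (le_of_eq ?_)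
  unfold cI; ring

lemma N1 (d : ℕ) (α : ℝ) (hα0 : 0 ≤ α) (hα1 : α ≤ 1) (f : EE d → ℝ) (M H : ℝ)
    (hf : Measurable f) (hM : ∀ x, |f x| ≤ M) (hH0 : 0 ≤ H)
    (hH : ∀ x y, |f x - f y| ≤ H * ‖x - y‖ ^ α)
    (δ t : ℝ) (hδ : α / 2 ≤ δ) (hδ1 : δ ≤ 1) (ht : 1 ≤ t) (x : EE d) :
    |heatP d t f x - heatP d 1 f x| ≤ (cB d + cI d) * H * (t - 1) ^ δ := by
  have hB := cB_nonneg d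
  have hI := cI_nonneg d
  have hu : 0 ≤ t - 1 := by linarith
  rcases le_total t 2 with h | h
  · refine (LB d α hα0 hα1 f M H hf hM hH0 hH t ht h x).trans ?_
    have := Real.rpow_le_rpow_of_exponent_ge' hu (by linarith) (by linarith) hδ1
    rw [Real.rpow_one] at this
    gcongr
    linarith
  · refine (LA d α hα0 hα1 f M H hf hM hH0 hH t ht x).trans ?_
    have := Real.rpow_le_rpow_of_exponent_le (by linarith : 1 ≤ t - 1) hδ
    gcongr
    linarith

lemma LEst (d : ℕ) (α : ℝ) (hα0 : 0 ≤ α) (hα1 : α ≤ 1) (f : EE d → ℝ) (M H : ℝ)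
    (hf : Measurable f) (hM : ∀ x, |f x| ≤ M) (hH0 : 0 ≤ H)
    (hH : ∀ x y, |f x - f y| ≤ H * ‖x - y‖ ^ α)
    (t β : ℝ) (hβ1 : β ≤ 1) (hαβ : α ≤ β) (ht : 1 ≤ t) (x y : EE d) :
    |heatP d t f x - heatP d t f y| ≤ (cB d + 1) * H * ‖x - y‖ ^ β := by
  have hB := cB_nonneg d
  have hs : 1 ≤ √t := by simpa using ht
  have hs0 : 0 < √t := by linarith
  rcases le_total 1 ‖x - y‖ with h | h
  · refine (LD1 d α f M H hf hM hH t (by linarith) x y).trans ?_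
    have := Real.rpow_le_rpow_of_exponent_le h hαβ
    calc H * ‖x - y‖ ^ α ≤ H * ‖x - y‖ ^ β := by gcongr
      _ = (0 + 1) * H * ‖x - y‖ ^ β := by ring
      _ ≤ _ := by gcongr
  · have t0 : 0 < t := by linarith
    rw [heatP_scaling d t t t0 t0 f x, heatP_scaling d t t t0 t0 f y, div_self t0.ne']
    have hd : ‖(√t)⁻¹ • x - (√t)⁻¹ • y‖ = ‖x - y‖ / √t := by
      rw [← smul_sub, norm_smul, norm_inv, Real.norm_of_nonneg hs0.le]; field_simp
    have h1 := LD2 d α hα0 hα1 (fun z => f (√t • z)) M (H * √t ^ α) (hf.comp (by fun_prop))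
      (fun z => hM _) (by positivity) (fun u v => by
        refine (hH _ _).trans (le_of_eq ?_)
        rw [← smul_sub, norm_smul, Real.norm_of_nonneg hs0.le,
          Real.mul_rpow hs0.le (norm_nonneg _)]; ring)
      ((√t)⁻¹ • x) ((√t)⁻¹ • y) (by
        rw [hd]; exact (div_le_self (norm_nonneg _) hs).trans h)
    rw [hd] at h1
    refine h1.trans ?_
    have e1 : √t ^ α ≤ √t := by
      simpa using Real.rpow_le_rpow_of_exponent_le hs hα1
    have e2 : ‖x - y‖ ≤ ‖x - y‖ ^ β := by
      simpa using Real.rpow_le_rpow_of_exponent_ge' (norm_nonneg (x - y)) h (by linarith) hβ1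
    calc cB d * (H * √t ^ α) * (‖x - y‖ / √t) ≤ cB d * (H * √t) * (‖x - y‖ / √t) := by gcongr
      _ = cB d * H * ‖x - y‖ := by field_simp
      _ ≤ cB d * H * ‖x - y‖ ^ β := by gcongr
      _ ≤ _ := by gcongr; linarith

lemma N2 (d : ℕ) (α : ℝ) (hα0 : 0 ≤ α) (hα1 : α ≤ 1) (f : EE d → ℝ) (M H : ℝ)
    (hf : Measurable f) (hM : ∀ x, |f x| ≤ M) (hH0 : 0 ≤ H)
    (hH : ∀ x y, |f x - f y| ≤ H * ‖x - y‖ ^ α)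
    (β δ t : ℝ) (hβ0 : 0 ≤ β) (hβ1 : β ≤ 1) (hδ0 : 0 < δ) (hδ1 : δ ≤ 1)
    (hδ : α / 2 - β / 2 ≤ δ) (ht : 1 ≤ t) (x y : EE d) :
    |(heatP d t f x - heatP d 1 f x) - (heatP d t f y - heatP d 1 f y)|
      ≤ (2 * cB d + 2 * cI d + 2) * H * (t - 1) ^ δ * ‖x - y‖ ^ β := by
  have hB := cB_nonneg d
  have hI := cI_nonneg d
  have hu : 0 ≤ t - 1 := by linarith
  have hn := norm_nonneg (x - y)
  have hud : 0 ≤ (t - 1) ^ δ := Real.rpow_nonneg hu _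
  rcases le_total t 2 with h | h
  · have h1 : t - 1 ≤ (t - 1) ^ δ := by
      simpa using Real.rpow_le_rpow_of_exponent_ge' hu (by linarith) hδ0.le hδ1
    rcases le_total ‖x - y‖ 1 with hx | hx
    · refine (LC d α hα0 hα1 f M H hf hM hH0 hH t ht h x y hx).trans ?_
      have e2 : ‖x - y‖ ≤ ‖x - y‖ ^ β := by
        simpa using Real.rpow_le_rpow_of_exponent_ge' (norm_nonneg (x - y)) hx hβ0 hβ1
      calc _ ≤ cB d * H * ((t - 1) ^ δ * ‖x - y‖ ^ β) := by gcongr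
        _ = cB d * H * (t - 1) ^ δ * ‖x - y‖ ^ β := by ring
        _ ≤ _ := by gcongr; linarith
    · have a1 := LB d α hα0 hα1 f M H hf hM hH0 hH t ht h x
      have a2 := LB d α hα0 hα1 f M H hf hM hH0 hH t ht h y
      have e2 : 1 ≤ ‖x - y‖ ^ β := Real.one_le_rpow hx hβ0
      refine (abs_sub _ _).trans ((add_le_add a1 a2).trans ?_)
      calc _ = 2 * cB d * H * (t - 1) * 1 := by ring
        _ ≤ 2 * cB d * H * (t - 1) ^ δ * ‖x - y‖ ^ β := by gcongr
        _ ≤ _ := by gcongr; linarith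
  · have hu1 : 1 ≤ t - 1 := by linarith
    have e : (heatP d t f x - heatP d 1 f x) - (heatP d t f y - heatP d 1 f y)
      = (heatP d t f x - heatP d t f y) - (heatP d 1 f x - heatP d 1 f y) := by ring
    rcases le_total α β with hab | hab
    · have a1 := LEst d α hα0 hα1 f M H hf hM hH0 hH t β hβ1 hab ht x y
      have a2 := LEst d α hα0 hα1 f M H hf hM hH0 hH 1 β hβ1 hab le_rfl x y
      have e2 : 1 ≤ (t - 1) ^ δ := Real.one_le_rpow hu1 hδ0.le
      rw [e]
      refine (abs_sub _ _).trans ((add_le_add a1 a2).trans ?_)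
      calc _ = (2 * cB d + 2) * H * 1 * ‖x - y‖ ^ β := by ring
        _ ≤ (2 * cB d + 2) * H * (t - 1) ^ δ * ‖x - y‖ ^ β := by gcongr
        _ ≤ _ := by gcongr; linarith
    · have hsq : ∀ c : ℝ, (√(t - 1)) ^ c = (t - 1) ^ (c / 2) := fun c => by
        rw [Real.sqrt_eq_rpow, ← Real.rpow_mul hu]; congr 1; ring
      have e3 : (t - 1) ^ ((α - β) / 2) ≤ (t - 1) ^ δ :=
        Real.rpow_le_rpow_of_exponent_le hu1 (by linarith)
      rcases le_total ‖x - y‖ (√(t - 1)) with hx | hx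
      · have a1 := LD1 d α f M H hf hM hH t (by linarith) x y
        have a2 := LD1 d α f M H hf hM hH 1 one_pos x y
        have e4 : ‖x - y‖ ^ α ≤ (t - 1) ^ δ * ‖x - y‖ ^ β := by
          have : ‖x - y‖ ^ α = ‖x - y‖ ^ (α - β) * ‖x - y‖ ^ β := by
            rw [← Real.rpow_add_of_nonneg hn (by linarith) hβ0]; congr 1; ring
          rw [this]
          gcongr
          refine le_trans ?_ e3
          rw [← hsq]
          exact Real.rpow_le_rpow hn hx (by linarith)
        rw [e]
        refine (abs_sub _ _).trans ((add_le_add a1 a2).trans ?_)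
        calc _ = 2 * H * ‖x - y‖ ^ α := by ring
          _ ≤ 2 * H * ((t - 1) ^ δ * ‖x - y‖ ^ β) := by gcongr
          _ = 2 * H * (t - 1) ^ δ * ‖x - y‖ ^ β := by ring
          _ ≤ _ := by gcongr; linarith
      · have a1 := LA d α hα0 hα1 f M H hf hM hH0 hH t ht x
        have a2 := LA d α hα0 hα1 f M H hf hM hH0 hH t ht y
        have e4 : (t - 1) ^ (α / 2) ≤ (t - 1) ^ δ * ‖x - y‖ ^ β := by
          have : (t - 1) ^ (α / 2) = (t - 1) ^ ((α - β) / 2) * (√(t - 1)) ^ β := by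
            rw [hsq, ← Real.rpow_add (by linarith)]; congr 1; ring
          rw [this]
          gcongr
        refine (abs_sub _ _).trans ((add_le_add a1 a2).trans ?_)
        calc _ = 2 * cI d * H * (t - 1) ^ (α / 2) := by ring
          _ ≤ 2 * cI d * H * ((t - 1) ^ δ * ‖x - y‖ ^ β) := by gcongr
          _ = 2 * cI d * H * (t - 1) ^ δ * ‖x - y‖ ^ β := by ring
          _ ≤ _ := by gcongr; linarith

/-- Heat-kernel bound, Proposition 3.7(ii): for bounded measurable `f` of class
`C^α`, `δ ∈ (0,1]` with `δ ≥ α/2 - β/2`, and `0 < s ≤ t ≤ 1`,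
`‖P_t f - P_s f‖_{C^β} ≤ N ‖f‖_{C^α} s^{α/2-β/2-δ} (t-s)^δ` with `N = N(d,α,β,δ)`.
`Cf` is any admissible value of `‖f‖_{C^α}` (for `α = 0` only boundedness is
required), and the `C^β` bound is stated via sup norm and `β`-Hölder seminorm
(the latter only for `β ≠ 0`). -/
theorem stmt_8 (d : ℕ) (hd : 1 ≤ d) (α β δ : ℝ)
    (hα0 : 0 ≤ α) (hα1 : α ≤ 1) (hβ0 : 0 ≤ β) (hβ1 : β ≤ 1)
    (hδ0 : 0 < δ) (hδ1 : δ ≤ 1) (hδ : α/2 - β/2 ≤ δ) :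
    ∃ N : ℝ, 0 < N ∧
      ∀ (f : EuclideanSpace ℝ (Fin d) → ℝ) (Cf : ℝ), Measurable f → 0 ≤ Cf →
      (∀ x, |f x| ≤ Cf) →
      (α ≠ 0 → ∀ x y, |f x - f y| ≤ Cf * ‖x - y‖ ^ α) →
      ∀ s t : ℝ, 0 < s → s ≤ t → t ≤ 1 →
        (∀ x, |heatP d t f x - heatP d s f x|
          ≤ N * Cf * s ^ (α/2 - β/2 - δ) * (t - s) ^ δ) ∧
        (β ≠ 0 → ∀ x y, |(heatP d t f x - heatP d s f x) - (heatP d t f y - heatP d s f y)|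
          ≤ N * Cf * s ^ (α/2 - β/2 - δ) * (t - s) ^ δ * ‖x - y‖ ^ β) := by
  have hB := cB_nonneg d
  have hI := cI_nonneg d
  refine ⟨2 * (2 * cB d + 2 * cI d + 2), by positivity, ?_⟩
  intro f Cf hf hCf hb hH s t hs hst ht1
  have t0 : 0 < t := by linarith
  have hss : 0 < √s := Real.sqrt_pos.mpr hs
  have hts : 0 ≤ t - s := by linarith
  have hts' : 1 ≤ t / s := by rw [le_div_iff₀ hs]; linarith
  have hH2 : ∀ x y, |f x - f y| ≤ 2 * Cf * ‖x - y‖ ^ α := by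
    intro x y
    by_cases h0 : α = 0
    · rw [h0, Real.rpow_zero]
      have := abs_sub (f x) (f y)
      linarith [hb x, hb y]
    · refine (hH h0 x y).trans ?_
      gcongr
      linarith
  have hsq : ∀ c : ℝ, (√s) ^ c = s ^ (c / 2) := fun c => by
    rw [Real.sqrt_eq_rpow, ← Real.rpow_mul hs.le]; congr 1; ring
  have hHs : ∀ u v : EE d, |f (√s • u) - f (√s • v)| ≤ (2 * Cf * s ^ (α / 2)) * ‖u - v‖ ^ α := by
    intro u v
    refine (hH2 _ _).trans (le_of_eq ?_)
    rw [← smul_sub, norm_smul, Real.norm_of_nonneg hss.le,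
      Real.mul_rpow hss.le (norm_nonneg _), hsq]; ring
  have hfs : Measurable (fun z : EE d => f (√s • z)) := hf.comp (by fun_prop)
  have hdiv : ∀ c : ℝ, (t / s - 1) ^ c = (t - s) ^ c * s ^ (-c) := fun c => by
    have : t / s - 1 = (t - s) / s := by field_simp
    rw [this, Real.div_rpow hts hs.le, Real.rpow_neg hs.le]; rfl
  have hsc : ∀ x, heatP d t f x - heatP d s f x =
      heatP d (t / s) (fun z => f (√s • z)) ((√s)⁻¹ • x) -
        heatP d 1 (fun z => f (√s • z)) ((√s)⁻¹ • x) := fun x => by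
    rw [heatP_scaling d s t hs t0 f x, heatP_scaling d s s hs hs f x, div_self hs.ne']
  have hpos : 0 ≤ (t - s) ^ δ := Real.rpow_nonneg hts _
  constructor
  · intro x
    rw [hsc]
    have key : s ^ (α / 2) * (t / s - 1) ^ (max δ (α / 2)) ≤
        s ^ (α/2 - β/2 - δ) * (t - s) ^ δ := by
      rw [hdiv]
      rcases le_total (α / 2) δ with h | h
      · rw [max_eq_left h]
        have e1 : s ^ (α / 2) * ((t - s) ^ δ * s ^ (-δ)) = s ^ (α / 2 - δ) * (t - s) ^ δ := by
          rw [sub_eq_add_neg (α / 2) δ, Real.rpow_add hs]; ring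
        rw [e1]
        refine mul_le_mul_of_nonneg_right ?_ hpos
        exact Real.rpow_le_rpow_of_exponent_ge hs (by linarith) (by linarith)
      · rw [max_eq_right h]
        have e1 : s ^ (α / 2) * ((t - s) ^ (α / 2) * s ^ (-(α / 2))) = 1 * (t - s) ^ (α / 2) := by
          have : s ^ (α / 2) * s ^ (-(α / 2)) = 1 := by
            rw [← Real.rpow_add hs]; simp
          linear_combination (t - s) ^ (α / 2) * this
        rw [e1]
        apply mul_le_mul
        · exact Real.one_le_rpow_of_pos_of_le_one_of_nonpos hs (by linarith) (by linarith)
        · exact Real.rpow_le_rpow_of_exponent_ge' hts (by linarith) hδ0.le h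
        · exact Real.rpow_nonneg hts _
        · exact Real.rpow_nonneg hs.le _
    have h1 := N1 d α hα0 hα1 _ Cf _ hfs (fun z => hb _) (by positivity) hHs (max δ (α / 2))
      (t / s) (le_max_right _ _) (max_le hδ1 (by linarith)) hts' ((√s)⁻¹ • x)
    refine h1.trans ?_
    calc _ = 2 * (cB d + cI d) * Cf * (s ^ (α / 2) * (t / s - 1) ^ (max δ (α / 2))) := by ring
      _ ≤ 2 * (cB d + cI d) * Cf * (s ^ (α/2 - β/2 - δ) * (t - s) ^ δ) := by gcongr
      _ ≤ 2 * (2 * cB d + 2 * cI d + 2) * Cf * (s ^ (α/2 - β/2 - δ) * (t - s) ^ δ) := by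
        have hc : 2 * (cB d + cI d) ≤ 2 * (2 * cB d + 2 * cI d + 2) := by linarith
        exact mul_le_mul_of_nonneg_right (mul_le_mul_of_nonneg_right hc hCf) (by positivity)
      _ = _ := by ring
  · intro _ x y
    rw [hsc, hsc]
    have h1 := N2 d α hα0 hα1 _ Cf _ hfs (fun z => hb _) (by positivity) hHs β δ
      (t / s) hβ0 hβ1 hδ0 hδ1 hδ hts' ((√s)⁻¹ • x) ((√s)⁻¹ • y)
    refine h1.trans (le_of_eq ?_)
    have hn : ‖(√s)⁻¹ • x - (√s)⁻¹ • y‖ ^ β = s ^ (-(β / 2)) * ‖x - y‖ ^ β := by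
      rw [← smul_sub, norm_smul, norm_inv, Real.norm_of_nonneg hss.le,
        Real.mul_rpow (by positivity) (norm_nonneg _), Real.inv_rpow hss.le, hsq,
        Real.rpow_neg hs.le]
    rw [hn, hdiv]
    have e1 : s ^ (α/2 - β/2 - δ) = s ^ (α / 2) * s ^ (-(β / 2)) * s ^ (-δ) := by
      rw [← Real.rpow_add hs, ← Real.rpow_add hs]; congr 1
    rw [e1]; ring
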